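/- arXiv:1606.09494 — 13 statements merged into one kernel-verified Lean document; each statement's English description precedes it below -/
import Mathlib

section
/- Let W be a reasonable channel on a finite set X. Then W is metrizable if and only if the directed graph G(W) is cycle-reverter. -/
/-- A (discrete memoryless) channel on a finite alphabet `X`:
`Pr x y` is the probability of receiving `x` when `y` was sent. -/
def IsChannel {X : Type*} [Fintype X] (Pr : X → X → ℝ) : Prop :=
  (∀ x y : X, 0 ≤ Pr x y) ∧ ∀ y : X, ∑ x : X, Pr x y = 1

/-- A channel is reasonable if `Pr(x|x) > Pr(x|y)` for all `y ≠ x`. -/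
def Reasonable {X : Type*} (Pr : X → X → ℝ) : Prop :=
  ∀ x y : X, y ≠ x → Pr x y < Pr x x

/-- `d` is a metric on `X`. -/
def IsMetric {X : Type*} (d : X → X → ℝ) : Prop :=
  (∀ x y : X, d x y = 0 ↔ x = y) ∧ (∀ x y : X, d x y = d y x) ∧
    ∀ x y z : X, d x z ≤ d x y + d y z

/-- A metric `d` is matched to the channel `Pr` if
`Pr(x|y) ≤ Pr(x|z) ↔ d(x,y) ≥ d(x,z)` for all `x, y, z`. -/
def Matched {X : Type*} (Pr d : X → X → ℝ) : Prop :=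
  ∀ x y z : X, Pr x y ≤ Pr x z ↔ d x z ≤ d x y

/-- A channel is metrizable if some metric on `X` is matched to it. -/
def Metrizable {X : Type*} (Pr : X → X → ℝ) : Prop :=
  ∃ d : X → X → ℝ, IsMetric d ∧ Matched Pr d

/-- The edge relation of the directed graph `G(W)`: vertices are the 2-element
subsets of `X` and there is an edge from `{x,y}` to `{x,z}` whenever `y ≠ z`
and `Pr(x|y) ≤ Pr(x|z)`. -/
def GEdge {X : Type*} [DecidableEq X] (Pr : X → X → ℝ) (v w : Finset X) : Prop :=
  ∃ x y z : X, x ≠ y ∧ x ≠ z ∧ y ≠ z ∧ v = {x, y} ∧ w = {x, z} ∧ Pr x y ≤ Pr x z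

/-- A directed graph (given by its edge relation `E`) is cycle-reverter if for every
directed closed walk `v 0 → v 1 → ⋯ → v (r-1) → v 0`, all reversed edges are also
edges of the graph. -/
def CycleReverter {V : Type*} (E : V → V → Prop) : Prop :=
  ∀ r : ℕ, 0 < r → ∀ v : ℕ → V,
    (∀ i < r, E (v i) (v ((i + 1) % r))) → ∀ i < r, E (v ((i + 1) % r)) (v i)

/-- The endpoints of an edge determine the defining inequality. -/
theorem le_of_GEdge_pair {X : Type*} [DecidableEq X] {Pr : X → X → ℝ} {x y z : X}
    (h : GEdge Pr {x, y} {x, z}) : Pr x y ≤ Pr x z := by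
  obtain ⟨a, b, c, hab, hac, hbc, h₁, h₂, hle⟩ := h
  have ha₁ : a ∈ ({x, y} : Finset X) := by simp [h₁]
  have ha₂ : a ∈ ({x, z} : Finset X) := by simp [h₂]
  have hb : b ∈ ({x, y} : Finset X) := by simp [h₁]
  have hc : c ∈ ({x, z} : Finset X) := by simp [h₂]
  simp only [Finset.mem_insert, Finset.mem_singleton] at ha₁ ha₂ hb hc
  grind

theorem Relation.ReflTransGen.exists_walk {V : Type*} {E : V → V → Prop} {a b : V}
    (h : Relation.ReflTransGen E a b) :
    ∃ (n : ℕ) (f : ℕ → V), f 0 = a ∧ f n = b ∧ ∀ i < n, E (f i) (f (i + 1)) := by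
  induction h using Relation.ReflTransGen.head_induction_on with
  | refl => exact ⟨0, fun _ => b, rfl, rfl, by simp⟩
  | @head a c hac _ ih =>
    obtain ⟨n, f, h₀, hn, hf⟩ := ih
    refine ⟨n + 1, fun i => Nat.casesOn i a f, rfl, hn, ?_⟩
    rintro (_ | i) hi
    · simpa [h₀] using hac
    · exact hf i (by omega)

/-- In a cycle-reverter graph, an edge lying on a directed cycle can be reversed. -/
theorem CycleReverter.symm_of_reflTransGen {V : Type*} {E : V → V → Prop}
    (hE : CycleReverter E) {v w : V} (hvw : E v w) (hwv : Relation.ReflTransGen E w v) :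
    E w v := by
  obtain ⟨n, f, h₀, hn, hf⟩ := hwv.exists_walk
  have key := hE (n + 1) n.succ_pos f ?_ n n.lt_succ_self
  · simpa [h₀, hn] using key
  · intro i hi
    rcases Nat.lt_succ_iff_lt_or_eq.mp hi with hi | rfl
    · rw [Nat.mod_eq_of_lt (by omega)]
      exact hf i hi
    · simpa [h₀, hn] using hvw

/-- A finite cycle-reverter graph has a height function that is weakly decreasing along edges and
strictly decreasing along edges that cannot be reversed. -/
theorem CycleReverter.exists_height {V : Type*} [Finite V] {E : V → V → Prop}
    (hE : CycleReverter E) :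
    ∃ D : V → ℕ, (∀ v w, E v w → D w ≤ D v) ∧ ∀ v w, E v w → ¬ E w v → D w < D v := by
  have hsub : ∀ v w, E v w →
      {u | Relation.ReflTransGen E w u} ⊆ {u | Relation.ReflTransGen E v u} :=
    fun v w h u hu => Relation.ReflTransGen.head h hu
  refine ⟨fun v => {u | Relation.ReflTransGen E v u}.ncard,
    fun v w h => Set.ncard_le_ncard (hsub v w h) (Set.toFinite _),
    fun v w h hn => Set.ncard_lt_ncard ⟨hsub v w h, fun hs => hn ?_⟩ (Set.toFinite _)⟩
  exact hE.symm_of_reflTransGen h (hs Relation.ReflTransGen.refl)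

/-- A graph whose edges weakly decrease a real function, and can be reversed when the function is
constant along them, is cycle-reverter. -/
theorem CycleReverter.of_height {V : Type*} {E : V → V → Prop} (D : V → ℝ)
    (hle : ∀ v w, E v w → D w ≤ D v) (hrev : ∀ v w, E v w → D v = D w → E w v) :
    CycleReverter E := by
  intro r hr v hv i hi
  have hanti : Antitone fun j => D (v (j % r)) := by
    refine antitone_nat_of_succ_le fun j => ?_
    have := hle _ _ (hv (j % r) (Nat.mod_lt _ hr))
    rwa [Nat.mod_add_mod] at this
  refine hrev _ _ (hv i hi) (le_antisymm ?_ (hle _ _ (hv i hi)))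
  have h₁ := hanti (Nat.zero_le i)
  have h₂ := hanti (Nat.succ_le_of_lt hi)
  simp only [Nat.mod_self, Nat.zero_mod, Nat.mod_eq_of_lt hi, Nat.succ_eq_add_one] at h₁ h₂
  exact h₁.trans h₂

theorem Metrizable.cycleReverter {X : Type*} [DecidableEq X] {Pr : X → X → ℝ}
    (h : Metrizable Pr) : CycleReverter (GEdge Pr) := by
  obtain ⟨d, ⟨hd₀, hdsymm, -⟩, hm⟩ := h
  have hD : ∀ x y : X, x ≠ y →
      ∑ a ∈ ({x, y} : Finset X), ∑ b ∈ ({x, y} : Finset X), d a b = 2 * d x y := by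
    intro x y hxy
    simp only [Finset.sum_pair hxy, (hd₀ _ _).mpr rfl, hdsymm y x]
    ring
  refine CycleReverter.of_height (fun v => ∑ a ∈ v, ∑ b ∈ v, d a b) ?_ ?_
  · rintro _ _ ⟨x, y, z, hxy, hxz, -, rfl, rfl, hle⟩
    have := (hm x y z).mp hle
    simp only [hD x y hxy, hD x z hxz]
    linarith
  · rintro _ _ ⟨x, y, z, hxy, hxz, hyz, rfl, rfl, -⟩ heq
    simp only [hD x y hxy, hD x z hxz] at heq
    exact ⟨x, z, y, hxz, hxy, hyz.symm, rfl, rfl, (hm x z y).mpr (by linarith)⟩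

theorem isMetric_of_mem_Icc {X : Type*} {d : X → X → ℝ} (h₀ : ∀ x, d x x = 0)
    (hsymm : ∀ x y, d x y = d y x) (hd : ∀ x y, x ≠ y → d x y ∈ Set.Icc 1 2) : IsMetric d := by
  have hpos : ∀ x y, x ≠ y → d x y ≠ 0 := fun x y hxy => by linarith [(hd x y hxy).1]
  refine ⟨fun x y => ⟨fun h => by_contra fun hxy => hpos x y hxy h, ?_⟩, hsymm, ?_⟩
  · rintro rfl
    exact h₀ x
  · intro x y z
    by_cases hxy : x = y
    · simp [hxy, h₀]
    by_cases hyz : y = z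
    · simp [hyz, h₀]
    by_cases hxz : x = z
    · subst hxz
      linarith [h₀ x, (hd x y hxy).1, (hd y x hyz).1]
    · linarith [(hd x y hxy).1, (hd y z hyz).1, (hd x z hxz).2]

theorem CycleReverter.metrizable {X : Type*} [Finite X] [DecidableEq X] {Pr : X → X → ℝ}
    (hre : Reasonable Pr) (hE : CycleReverter (GEdge Pr)) : Metrizable Pr := by
  obtain ⟨D, hle, hlt⟩ := hE.exists_height
  obtain ⟨N, hN⟩ := (Set.finite_range D).bddAbove
  have hDN : ∀ v, (D v : ℝ) ≤ N := fun v => by exact_mod_cast hN ⟨v, rfl⟩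
  have hpos : (0 : ℝ) < N + 1 := by positivity
  set d : X → X → ℝ := fun x y => if x = y then 0 else 1 + D {x, y} / (N + 1) with hd
  have hself : ∀ x, d x x = 0 := fun x => by simp [hd]
  have hne : ∀ x y, x ≠ y → d x y = 1 + D {x, y} / (N + 1) := fun x y h => by simp [hd, h]
  have hIcc : ∀ x y, x ≠ y → d x y ∈ Set.Icc 1 2 := by
    intro x y h
    have h₁ : (0 : ℝ) ≤ D {x, y} / (N + 1) := by positivity
    have h₂ : (D {x, y} : ℝ) / (N + 1) ≤ 1 := (div_le_one hpos).mpr (by linarith [hDN {x, y}])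
    rw [hne x y h]
    constructor <;> linarith
  refine ⟨d, isMetric_of_mem_Icc hself (fun x y => ?_) hIcc, fun x y z => ?_⟩
  · simp only [hd, eq_comm (a := x), Finset.pair_comm x]
  by_cases hyz : y = z
  · simp [hyz]
  by_cases hxy : x = y
  · subst hxy
    have h₁ := hre x z (Ne.symm hyz)
    have h₂ := (hIcc x z hyz).1
    rw [hself]
    exact iff_of_false (by linarith) (by linarith)
  by_cases hxz : x = z
  · subst hxz
    have h₁ := hre x y hyz
    have h₂ := (hIcc x y hxy).1
    rw [hself]
    exact iff_of_true h₁.le (by linarith)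
  rw [hne x y hxy, hne x z hxz, add_le_add_iff_left, div_le_div_iff_of_pos_right hpos,
    Nat.cast_le]
  refine ⟨fun h => hle _ _ ⟨x, y, z, hxy, hxz, hyz, rfl, rfl, h⟩, fun h => ?_⟩
  by_contra! hcon
  exact (hlt {x, z} {x, y} ⟨x, z, y, hxz, hxy, Ne.symm hyz, rfl, rfl, hcon.le⟩
    fun hrev => hcon.not_ge (le_of_GEdge_pair hrev)).not_ge h

/-- A reasonable channel is metrizable iff its associated graph `G(W)` is
cycle-reverter. -/
theorem stmt0 {X : Type*} [Fintype X] [DecidableEq X] [Nontrivial X]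
    (Pr : X → X → ℝ) (hch : IsChannel Pr) (hre : Reasonable Pr) :
    Metrizable Pr ↔ CycleReverter (GEdge Pr) := by
  exact ⟨Metrizable.cycleReverter, CycleReverter.metrizable hre⟩
end

section
/- For every n ≥ 1 and every p, q ∈ (0,1) with p + q < 1, the directed graph G(W) associated with the channel W = BAC^n(p,q) is cycle-reverter. -/
/-- Single-use binary asymmetric channel: `bacPr1 p q x y` is the probability of
receiving `x` when `y` was sent, with `Pr(1|0) = p`, `Pr(0|0) = 1-p`,
`Pr(0|1) = q`, `Pr(1|1) = 1-q`. -/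
def bacPr1 (p q : ℝ) (x y : ZMod 2) : ℝ :=
  if y = 0 then (if x = 0 then 1 - p else p) else (if x = 0 then q else 1 - q)

/-- The `n`-fold binary asymmetric channel `BAC^n(p,q)` on `(ℤ/2ℤ)^n`. -/
def bacPr (p q : ℝ) (n : ℕ) (x y : Fin n → ZMod 2) : ℝ :=
  ∏ i : Fin n, bacPr1 p q (x i) (y i)

/-- A relation along which some real potential is nondecreasing, and which contains the reverse
of each of its edges joining equal potentials, is cycle-reverter. -/
theorem CycleReverter.of_potential {V : Type*} {E : V → V → Prop} (f : V → ℝ)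
    (hmono : ∀ v w, E v w → f v ≤ f w) (hrev : ∀ v w, E v w → f w ≤ f v → E w v) :
    CycleReverter E := by
  intro r hr v h i hi
  refine hrev _ _ (h i hi) ?_
  have hg : Monotone fun k : ℕ => f (v (k % r)) := by
    refine monotone_nat_of_le_succ fun k => ?_
    have := hmono _ _ (h (k % r) (Nat.mod_lt _ hr))
    rwa [Nat.mod_add_mod] at this
  have := hg (show i + 1 ≤ i + r by omega)
  simpa [Nat.mod_eq_of_lt hi] using this

/-- If `Pr` satisfies detailed balance with respect to a positive weight, then its graph is
cycle-reverter. -/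
theorem CycleReverter.of_detailed_balance {X : Type*} [DecidableEq X] (Pr : X → X → ℝ)
    (d : X → ℝ) (hd : ∀ x, 0 < d x) (hsymm : ∀ x y, d x * Pr x y = d y * Pr y x) :
    CycleReverter (GEdge Pr) := by
  have key : ∀ x y : X, x ≠ y →
      ∑ a ∈ ({x, y} : Finset X).offDiag, d a.1 * Pr a.1 a.2 = 2 * (d x * Pr x y) := by
    intro x y hxy
    have hoff : ({x, y} : Finset X).offDiag = {(x, y), (y, x)} := by
      ext ⟨a, b⟩
      simp only [Finset.mem_offDiag, Finset.mem_insert, Finset.mem_singleton, Prod.mk.injEq]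
      grind
    rw [hoff, Finset.sum_pair (by simp [hxy]), hsymm y x]
    ring
  refine .of_potential (fun v => ∑ a ∈ v.offDiag, d a.1 * Pr a.1 a.2) ?_ ?_
  · rintro _ _ ⟨x, y, z, hxy, hxz, -, rfl, rfl, h⟩
    simp only [key x y hxy, key x z hxz]
    have := mul_le_mul_of_nonneg_left h (hd x).le
    linarith
  · rintro _ _ ⟨x, y, z, hxy, hxz, hyz, rfl, rfl, -⟩ h
    simp only [key x y hxy, key x z hxz] at h
    exact ⟨x, z, y, hxz, hxy, hyz.symm, rfl, rfl, le_of_mul_le_mul_left (by linarith) (hd x)⟩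

/-- The binary asymmetric channel satisfies detailed balance with weights `p` at `0` and
`q` at `1`. -/
theorem bacPr1_detailed_balance (p q : ℝ) (x y : ZMod 2) :
    (if x = 0 then p else q) * bacPr1 p q x y = (if y = 0 then p else q) * bacPr1 p q y x := by
  have h : ∀ a : ZMod 2, a = 0 ∨ a = 1 := by decide
  rcases h x with rfl | rfl <;> rcases h y with rfl | rfl <;> simp [bacPr1, mul_comm]

/-- For every `n ≥ 1` and `p, q ∈ (0,1)` with `p + q < 1`, the graph `G(W)`
associated with `W = BAC^n(p,q)` is cycle-reverter. -/
theorem stmt2 (n : ℕ) (hn : 1 ≤ n) (p q : ℝ)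
    (hp : p ∈ Set.Ioo (0 : ℝ) 1) (hq : q ∈ Set.Ioo (0 : ℝ) 1) (hpq : p + q < 1) :
    CycleReverter (GEdge (bacPr p q n)) := by
  refine .of_detailed_balance _ (fun x => ∏ i, if x i = 0 then p else q) ?_ ?_
  · intro x
    refine Finset.prod_pos fun i _ => ?_
    split_ifs
    exacts [hp.1, hq.1]
  · intro x y
    simp only [bacPr, ← Finset.prod_mul_distrib]
    exact Finset.prod_congr rfl fun i _ => bacPr1_detailed_balance p q (x i) (y i)
end

section
/- If a reasonable channel W on a finite set X is metrizable, then its associated directed graph G_1(W) is acyclic. -/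
/-- The edge relation of the directed graph `G₁(W)`: vertices are the 2-element
subsets of `X` and there is an edge from `{x,y}` to `{x,z}` whenever `y ≠ z`
and `Pr(x|y) < Pr(x|z)`. -/
def G1Edge {X : Type*} [DecidableEq X] (Pr : X → X → ℝ) (v w : Finset X) : Prop :=
  ∃ x y z : X, x ≠ y ∧ x ≠ z ∧ y ≠ z ∧ v = {x, y} ∧ w = {x, z} ∧ Pr x y < Pr x z

/-- A directed graph (given by its edge relation `E`) is acyclic if it contains
no directed closed walk of positive length. -/
def Acyclic {V : Type*} (E : V → V → Prop) : Prop :=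
  ∀ r : ℕ, 0 < r → ∀ v : ℕ → V, ¬ (∀ i < r, E (v i) (v ((i + 1) % r)))

/-- A relation along which a real-valued function strictly decreases is acyclic. -/
theorem acyclic_of_strictly_decreasing {V : Type*} {E : V → V → Prop} (f : V → ℝ)
    (h : ∀ v w, E v w → f w < f v) : Acyclic E := by
  intro r hr v hv
  obtain ⟨i, hi, hmin⟩ := Finset.exists_min_image (Finset.range r) (fun i => f (v i))
    ⟨0, Finset.mem_range.2 hr⟩
  exact (h _ _ (hv i (Finset.mem_range.1 hi))).not_ge
    (hmin _ (Finset.mem_range.2 (Nat.mod_lt _ hr)))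

/-- The sum of all distances between the points of a pair is twice their distance. -/
theorem IsMetric.sum_pair {X : Type*} [DecidableEq X] {d : X → X → ℝ} (hd : IsMetric d)
    {x y : X} (hxy : x ≠ y) :
    ∑ a ∈ ({x, y} : Finset X), ∑ b ∈ ({x, y} : Finset X), d a b = 2 * d x y := by
  simp only [Finset.sum_pair hxy, (hd.1 _ _).2 rfl, hd.2.1 y x]
  ring

/-- If a reasonable channel is metrizable then its associated graph `G₁(W)` is
acyclic. -/
theorem stmt3 {X : Type*} [Fintype X] [DecidableEq X] [Nontrivial X]
    (Pr : X → X → ℝ) (hch : IsChannel Pr) (hre : Reasonable Pr)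
    (hm : Metrizable Pr) :
    Acyclic (G1Edge Pr) := by
  obtain ⟨d, hd, hmatch⟩ := hm
  refine acyclic_of_strictly_decreasing (fun s => ∑ a ∈ s, ∑ b ∈ s, d a b) ?_
  rintro _ _ ⟨x, y, z, hxy, hxz, -, rfl, rfl, hlt⟩
  have hdlt : d x z < d x y := not_le.1 fun hle => hlt.not_ge ((hmatch x z y).2 hle)
  simp only [hd.sum_pair hxy, hd.sum_pair hxz]
  linarith
end

section
/- If a reasonable channel W on a finite set X is metrizable, then its associated directed graph G_1(W) is transitive. -/
/-- A directed graph on the 2-element subsets of `X` is transitive if for every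
directed path `v 0 → v 1 → ⋯ → v (r-1)` whose endpoints satisfy
`#(v 0 ∩ v (r-1)) = 1`, the edge `v 0 → v (r-1)` is also in the graph. -/
def TransitiveGraph {X : Type*} [DecidableEq X] (E : Finset X → Finset X → Prop) : Prop :=
  ∀ r : ℕ, 2 ≤ r → ∀ v : ℕ → Finset X,
    (∀ i, i + 1 < r → E (v i) (v (i + 1))) →
    (v 0 ∩ v (r - 1)).card = 1 → E (v 0) (v (r - 1))

/-- Twice the `d`-length of an edge, for a set with two elements. -/
noncomputable def pairwiseSum {X : Type*} (d : X → X → ℝ) (v : Finset X) : ℝ :=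
  ∑ a ∈ v, ∑ b ∈ v, d a b

lemma pairwiseSum_pair {X : Type*} [DecidableEq X] {d : X → X → ℝ} (hd : IsMetric d)
    {x y : X} (h : x ≠ y) : pairwiseSum d {x, y} = 2 * d x y := by
  have hx := (hd.1 x x).2 rfl
  have hy := (hd.1 y y).2 rfl
  have hs := hd.2.1 x y
  simp only [pairwiseSum, Finset.sum_pair h]
  linarith

lemma Matched.lt_iff {X : Type*} {Pr d : X → X → ℝ} (h : Matched Pr d) (x y z : X) :
    Pr x y < Pr x z ↔ d x z < d x y := by
  simpa only [not_le] using not_congr (h x z y)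

lemma G1Edge.pairwiseSum_lt {X : Type*} [DecidableEq X] {Pr d : X → X → ℝ}
    (hd : IsMetric d) (hmt : Matched Pr d) {v w : Finset X} (h : G1Edge Pr v w) :
    pairwiseSum d w < pairwiseSum d v := by
  obtain ⟨x, y, z, hxy, hxz, -, rfl, rfl, hlt⟩ := h
  rw [pairwiseSum_pair hd hxy, pairwiseSum_pair hd hxz]
  linarith [(hmt.lt_iff x y z).1 hlt]

lemma G1Edge.card_left {X : Type*} [DecidableEq X] {Pr : X → X → ℝ} {v w : Finset X}
    (h : G1Edge Pr v w) : v.card = 2 := by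
  obtain ⟨x, y, z, hxy, -, -, rfl, -, -⟩ := h
  exact Finset.card_pair hxy

lemma G1Edge.card_right {X : Type*} [DecidableEq X] {Pr : X → X → ℝ} {v w : Finset X}
    (h : G1Edge Pr v w) : w.card = 2 := by
  obtain ⟨x, y, z, -, hxz, -, -, rfl, -⟩ := h
  exact Finset.card_pair hxz

lemma exists_eq_pair_of_mem_of_card_eq_two {X : Type*} [DecidableEq X] {v : Finset X} {a : X}
    (hv : v.card = 2) (ha : a ∈ v) : ∃ b, a ≠ b ∧ v = {a, b} := by
  obtain ⟨x, y, hxy, rfl⟩ := Finset.card_eq_two.1 hv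
  rcases Finset.mem_insert.1 ha with rfl | h
  · exact ⟨y, hxy, rfl⟩
  · obtain rfl := Finset.mem_singleton.1 h
    exact ⟨x, hxy.symm, Finset.pair_comm _ _⟩

/-- Two-element sets meeting in one point are joined by an edge as soon as the length drops. -/
lemma g1Edge_of_pairwiseSum_lt {X : Type*} [DecidableEq X] {Pr d : X → X → ℝ}
    (hd : IsMetric d) (hmt : Matched Pr d) {v w : Finset X} (hv : v.card = 2)
    (hw : w.card = 2) (hvw : (v ∩ w).card = 1) (hlt : pairwiseSum d w < pairwiseSum d v) :
    G1Edge Pr v w := by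
  obtain ⟨a, ha⟩ := Finset.card_pos.1 (hvw ▸ Nat.one_pos)
  obtain ⟨hav, haw⟩ := Finset.mem_inter.1 ha
  obtain ⟨b, hab, rfl⟩ := exists_eq_pair_of_mem_of_card_eq_two hv hav
  obtain ⟨c, hac, rfl⟩ := exists_eq_pair_of_mem_of_card_eq_two hw haw
  rw [pairwiseSum_pair hd hab, pairwiseSum_pair hd hac] at hlt
  refine ⟨a, b, c, hab, hac, ?_, rfl, rfl, (hmt.lt_iff a b c).2 (by linarith)⟩
  rintro rfl
  rw [Finset.inter_self] at hvw
  omega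

/-- If a reasonable channel is metrizable then its associated graph `G₁(W)` is
transitive. -/
theorem stmt4 {X : Type*} [Fintype X] [DecidableEq X] [Nontrivial X]
    (Pr : X → X → ℝ) (hch : IsChannel Pr) (hre : Reasonable Pr)
    (hm : Metrizable Pr) :
    TransitiveGraph (G1Edge Pr) := by
  obtain ⟨d, hd, hmt⟩ := hm
  intro r hr v hE hcard
  obtain ⟨n, rfl⟩ := Nat.exists_eq_add_of_le' hr
  have hlt : ∀ i, i + 1 < n + 2 → pairwiseSum d (v (i + 1)) < pairwiseSum d (v 0) := by
    intro i
    induction i with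
    | zero => exact fun h => (hE 0 h).pairwiseSum_lt hd hmt
    | succ i ih => exact fun h => ((hE (i + 1) h).pairwiseSum_lt hd hmt).trans (ih (by omega))
  exact g1Edge_of_pairwiseSum_lt hd hmt (hE 0 (by omega)).card_left
    (hE n (by omega)).card_right hcard (hlt n (by omega))
end

section
/- Let W be a channel on a finite set X. If the directed graph G(W) is cycle-reverter, then the directed graph G_1(W) is transitive. -/
theorem G1Edge.gEdge {X : Type*} [DecidableEq X] {Pr : X → X → ℝ} {v w : Finset X}
    (h : G1Edge Pr v w) : GEdge Pr v w := by
  obtain ⟨x, y, z, hxy, hxz, hyz, hv, hw, hlt⟩ := h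
  exact ⟨x, y, z, hxy, hxz, hyz, hv, hw, hlt.le⟩

theorem G1Edge.card_eq_two {X : Type*} [DecidableEq X] {Pr : X → X → ℝ} {v w : Finset X}
    (h : G1Edge Pr v w) : v.card = 2 ∧ w.card = 2 := by
  obtain ⟨x, y, z, hxy, hxz, -, rfl, rfl, -⟩ := h
  exact ⟨Finset.card_pair hxy, Finset.card_pair hxz⟩

theorem G1Edge.not_gEdge_symm {X : Type*} [DecidableEq X] {Pr : X → X → ℝ} {v w : Finset X}
    (h : G1Edge Pr v w) : ¬ GEdge Pr w v := by
  obtain ⟨x, y, z, hxy, hxz, hyz, rfl, rfl, hlt⟩ := h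
  rintro ⟨x', z', y', hxz', hxy', hyz', hw, hv, hle⟩
  have hw' (t : X) : t = x ∨ t = z ↔ t = x' ∨ t = z' := by simpa using Finset.ext_iff.1 hw t
  have hv' (t : X) : t = x ∨ t = y ↔ t = x' ∨ t = y' := by simpa using Finset.ext_iff.1 hv t
  obtain rfl : x' = x := by have := hw' x'; have := hv' x'; grind
  obtain rfl : y' = y := by have := hv' y'; grind
  obtain rfl : z' = z := by have := hw' z'; grind
  exact hlt.not_ge hle

theorem Finset.exists_eq_pair_of_mem {X : Type*} [DecidableEq X] {s : Finset X} {a : X}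
    (hs : s.card = 2) (ha : a ∈ s) : ∃ b, a ≠ b ∧ s = {a, b} := by
  obtain ⟨x, y, hxy, rfl⟩ := Finset.card_eq_two.1 hs
  rcases Finset.mem_insert.1 ha with rfl | ha
  · exact ⟨y, hxy, rfl⟩
  · obtain rfl := Finset.mem_singleton.1 ha
    exact ⟨x, hxy.symm, Finset.pair_comm _ _⟩

/-- If the graph `G(W)` of a channel `W` is cycle-reverter, then the graph
`G₁(W)` is transitive. -/
theorem stmt5 {X : Type*} [Fintype X] [DecidableEq X] [Nontrivial X]
    (Pr : X → X → ℝ) (hch : IsChannel Pr)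
    (hcr : CycleReverter (GEdge Pr)) :
    TransitiveGraph (G1Edge Pr) := by
  intro r hr v hv hcard
  have hfirst : G1Edge Pr (v 0) (v 1) := hv 0 (by omega)
  have hlast : G1Edge Pr (v (r - 2)) (v (r - 1)) := by
    have := hv (r - 2) (by omega)
    rwa [show r - 2 + 1 = r - 1 by omega] at this
  obtain ⟨a, ha⟩ := Finset.card_eq_one.1 hcard
  have hmem : a ∈ v 0 ∩ v (r - 1) := ha ▸ Finset.mem_singleton_self a
  obtain ⟨ha0, har⟩ := Finset.mem_inter.1 hmem
  obtain ⟨b, hab, hb⟩ := Finset.exists_eq_pair_of_mem hfirst.card_eq_two.1 ha0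
  obtain ⟨c, hac, hc⟩ := Finset.exists_eq_pair_of_mem hlast.card_eq_two.2 har
  have hbc : b ≠ c := by
    rintro rfl
    rw [hb, hc, Finset.inter_self, Finset.card_pair hab] at hcard
    omega
  refine ⟨a, b, c, hab, hac, hbc, hb, hc, ?_⟩
  by_contra! hle
  have hback : GEdge Pr (v (r - 1)) (v 0) := ⟨a, c, b, hac, hab, hbc.symm, hc, hb, hle⟩
  have hrev := hcr r (by omega) v (fun i hi => by
    rcases Nat.lt_or_ge (i + 1) r with h | h
    · rw [Nat.mod_eq_of_lt h]
      exact (hv i h).gEdge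
    · obtain rfl : i = r - 1 := by omega
      rwa [Nat.sub_add_cancel (by omega), Nat.mod_self]) 0 (by omega)
  rw [Nat.mod_eq_of_lt (by omega)] at hrev
  exact hfirst.not_gEdge_symm hrev
end

section
/- Let W be a channel on a finite set X. If the directed graph G_1(W) is transitive, then G_1(W) is acyclic. -/
theorem G1Edge.card_inter {X : Type*} [DecidableEq X] {Pr : X → X → ℝ} {v w : Finset X}
    (h : G1Edge Pr v w) : (v ∩ w).card = 1 := by
  obtain ⟨x, y, z, hxy, hxz, hyz, rfl, rfl, -⟩ := h
  rw [Finset.card_eq_one]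
  refine ⟨x, ?_⟩
  ext t
  simp only [Finset.mem_inter, Finset.mem_insert, Finset.mem_singleton]
  grind

theorem G1Edge.asymm {X : Type*} [DecidableEq X] {Pr : X → X → ℝ} {v w : Finset X}
    (h : G1Edge Pr v w) : ¬ G1Edge Pr w v := by
  obtain ⟨x, y, z, hxy, hxz, hyz, rfl, rfl, hlt⟩ := h
  rintro ⟨a, b, c, hab, hac, hbc, hw, hv, hlt'⟩
  have mem_v (t : X) : t = x ∨ t = y ↔ t = a ∨ t = c := by
    simpa using Finset.ext_iff.mp hv t
  have mem_w (t : X) : t = x ∨ t = z ↔ t = a ∨ t = b := by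
    simpa using Finset.ext_iff.mp hw t
  obtain rfl : x = a := by grind [mem_v x, mem_w x]
  obtain rfl : y = c := by grind [mem_v y]
  obtain rfl : z = b := by grind [mem_w z]
  exact lt_asymm hlt hlt'

/-- If the graph `G₁(W)` of a channel `W` is transitive, then it is acyclic. -/
theorem stmt6 {X : Type*} [Fintype X] [DecidableEq X] [Nontrivial X]
    (Pr : X → X → ℝ) (hch : IsChannel Pr)
    (ht : TransitiveGraph (G1Edge Pr)) :
    Acyclic (G1Edge Pr) := by
  intro r hr v h
  have hedge : G1Edge Pr (v 0) (v (1 % r)) := by simpa using h 0 hr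
  obtain rfl | hr2 : r = 1 ∨ 2 ≤ r := by omega
  · exact hedge.asymm hedge
  have hlast : v ((r - 1 + 1) % r) = v 0 := by
    rw [Nat.sub_add_cancel hr, Nat.mod_self]
  have hback := ht r hr2 (fun i => v ((i + 1) % r))
    (fun i hi => by simpa only [Nat.mod_eq_of_lt hi] using h (i + 1) hi)
  simp only [zero_add, hlast] at hback
  exact hedge.asymm (hback (by rw [Finset.inter_comm]; exact hedge.card_inter))
end

section
/- Let (P, c) be a colored poset with P finite. Then there exists a height function h on P such that every monochromatic subset of P is horizontal with respect to h. -/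
/-- `(P, c)` is a colored poset: `c` is a coloration (comparable distinct elements
get different colors) and every colored cycle is monochromatic. A colored cycle is
a sequence `x 0, x 1, …, x r` with `x r = x 0` such that `x i < x (i+1)` whenever
`c (x i) ≠ c (x (i+1))`; it is monochromatic if `c` is constant on it. -/
def ColoredPoset {P C : Type*} [PartialOrder P] (c : P → C) : Prop :=
  (∀ x y : P, x < y → c x ≠ c y) ∧
    ∀ r : ℕ, ∀ x : ℕ → P, x r = x 0 →
      (∀ i < r, c (x i) ≠ c (x (i + 1)) → x i < x (i + 1)) →
      ∀ i ≤ r, c (x i) = c (x 0)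

theorem Relation.ReflTransGen.exists_seq {α : Type*} {R : α → α → Prop} {a b : α}
    (h : Relation.ReflTransGen R a b) :
    ∃ (r : ℕ) (x : ℕ → α), x 0 = a ∧ x r = b ∧ ∀ i < r, R (x i) (x (i + 1)) := by
  induction h using Relation.ReflTransGen.head_induction_on with
  | refl => exact ⟨0, fun _ => b, rfl, rfl, by simp⟩
  | @head a d hab _ ih =>
    obtain ⟨r, x, h0, hr, hx⟩ := ih
    refine ⟨r + 1, fun n => Nat.casesOn n a x, rfl, hr, ?_⟩
    rintro (_ | i) hi
    · simpa [h0] using hab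
    · exact hx i (by omega)

/-- A step of a colored cycle. -/
def ColoredStep {P C : Type*} [PartialOrder P] (c : P → C) (a b : P) : Prop :=
  c a ≠ c b → a < b

/-- In a colored poset, no sequence of colored steps leads back from `y` to `x < y`. -/
theorem ColoredPoset.not_reflTransGen_of_lt {P C : Type*} [PartialOrder P] {c : P → C}
    (hc : ColoredPoset c) {x y : P} (hxy : x < y) :
    ¬ Relation.ReflTransGen (ColoredStep c) y x := by
  intro h
  have hstep : ColoredStep c x y := fun _ => hxy
  obtain ⟨r, u, h0, hr, hu⟩ := h.exists_seq
  have hcycle := hc.2 (r + 1) (fun n => Nat.casesOn n x u) hr (by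
    rintro (_ | i) hi
    · simpa [h0, ColoredStep] using hstep
    · exact hu i (by omega)) 1 (by omega)
  exact hc.1 x y hxy (by simpa [h0] using hcycle.symm)

/-- For every finite colored poset `(P, c)` there is a height function `h`
(i.e. `x < y → h x < h y`) such that every monochromatic subset of `P` is
horizontal with respect to `h` (i.e. `h` is constant on each color class). -/
theorem stmt7 {P C : Type*} [PartialOrder P] [Fintype P] [Fintype C] (c : P → C)
    (hc : ColoredPoset c) :
    ∃ h : P → ℕ, (∀ x y : P, x < y → h x < h y) ∧
      ∀ x y : P, c x = c y → h x = h y := by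
  refine ⟨fun x => {z | Relation.ReflTransGen (ColoredStep c) z x}.ncard, ?_, ?_⟩
  · intro x y hxy
    refine Set.ncard_lt_ncard ⟨fun z hz => ?_, fun hsub => ?_⟩ (Set.toFinite _)
    · exact Relation.ReflTransGen.tail hz fun _ => hxy
    · exact hc.not_reflTransGen_of_lt hxy (hsub Relation.ReflTransGen.refl)
  · intro x y hxy
    refine congrArg Set.ncard (Set.ext fun z => ?_)
    exact ⟨fun hz => Relation.ReflTransGen.tail hz fun hne => absurd hxy hne,
      fun hz => Relation.ReflTransGen.tail hz fun hne => absurd hxy.symm hne⟩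
end

section
/- Let p, q ∈ (0,1), n ≥ 1, r ≥ 1, and let x_0, x_1, …, x_{r−1} ∈ (ℤ/2ℤ)^n (indices taken modulo r). Then for the channel BAC^n(p,q), ∏_{i=0}^{r−1} Pr(x_i|x_{i+1}) = ∏_{i=0}^{r−1} Pr(x_i|x_{i−1}). -/
/-- The unnormalised stationary weight of the single-use binary asymmetric channel. -/
def bacWeight1 (p q : ℝ) (y : ZMod 2) : ℝ :=
  if y = 0 then q else p

/-- The unnormalised stationary weight of the `n`-fold binary asymmetric channel. -/
def bacWeight (p q : ℝ) (n : ℕ) (y : Fin n → ZMod 2) : ℝ :=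
  ∏ i : Fin n, bacWeight1 p q (y i)

theorem bacPr1_mul_bacWeight1 (p q : ℝ) (x y : ZMod 2) :
    bacPr1 p q x y * bacWeight1 p q y = bacPr1 p q y x * bacWeight1 p q x := by
  unfold bacPr1 bacWeight1
  split_ifs <;> ring

/-- Detailed balance for the `n`-fold binary asymmetric channel. -/
theorem bacPr_mul_bacWeight (p q : ℝ) (n : ℕ) (x y : Fin n → ZMod 2) :
    bacPr p q n x y * bacWeight p q n y = bacPr p q n y x * bacWeight p q n x := by
  simp only [bacPr, bacWeight, ← Finset.prod_mul_distrib, bacPr1_mul_bacWeight1 p q (x _)]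

theorem bacWeight_ne_zero {p q : ℝ} (hp : p ≠ 0) (hq : q ≠ 0) (n : ℕ) (y : Fin n → ZMod 2) :
    bacWeight p q n y ≠ 0 := by
  refine Finset.prod_ne_zero_iff.mpr fun i _ => ?_
  unfold bacWeight1
  split_ifs <;> assumption

/-- Reindexing a cyclic product by the successor modulo `r`. -/
theorem prod_range_pred_mod {M : Type*} [CommMonoid M] {r : ℕ} (hr : 1 ≤ r) (F : ℕ → ℕ → M) :
    ∏ i ∈ Finset.range r, F i ((i + r - 1) % r) =
      ∏ i ∈ Finset.range r, F ((i + 1) % r) i := by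
  obtain ⟨k, rfl⟩ := Nat.exists_eq_add_of_le' hr
  rw [Finset.prod_range_succ', Finset.prod_range_succ]
  congr 1
  · refine Finset.prod_congr rfl fun i hi => ?_
    have hi : i < k := Finset.mem_range.mp hi
    have hpred : (i + 1 + (k + 1) - 1) % (k + 1) = i := by
      rw [show i + 1 + (k + 1) - 1 = i + (k + 1) by lia, Nat.add_mod_right,
        Nat.mod_eq_of_lt (by lia)]
    rw [hpred, Nat.mod_eq_of_lt (by lia : i + 1 < k + 1)]
  · simp

/-- For `p, q ∈ (0,1)`, `n ≥ 1`, `r ≥ 1` and `x 0, …, x (r-1) ∈ (ℤ/2ℤ)^n`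
(indices mod `r`): `∏_{i<r} Pr(x_i|x_{i+1}) = ∏_{i<r} Pr(x_i|x_{i-1})`. -/
theorem stmt11 (p q : ℝ) (hp : p ∈ Set.Ioo (0 : ℝ) 1) (hq : q ∈ Set.Ioo (0 : ℝ) 1)
    (n : ℕ) (hn : 1 ≤ n) (r : ℕ) (hr : 1 ≤ r) (x : ℕ → Fin n → ZMod 2) :
    ∏ i ∈ Finset.range r, bacPr p q n (x i) (x ((i + 1) % r)) =
      ∏ i ∈ Finset.range r, bacPr p q n (x i) (x ((i + r - 1) % r)) := by
  have hw (y : Fin n → ZMod 2) : bacWeight p q n y ≠ 0 :=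
    bacWeight_ne_zero hp.1.ne' hq.1.ne' n y
  rw [prod_range_pred_mod hr fun i j => bacPr p q n (x i) (x j)]
  refine mul_right_cancel₀
    (Finset.prod_ne_zero_iff.mpr fun i (_ : i ∈ Finset.range r) => hw (x i)) ?_
  nth_rewrite 1 [prod_range_pred_mod hr fun i _ => bacWeight p q n (x i)]
  simp only [← Finset.prod_mul_distrib, bacPr_mul_bacWeight p q n (x _) (x ((_ + 1) % r))]
end

section
/- Let n ≥ 1 and p, q ∈ [0,1]. The channel BAC^n(p,q) is reasonable, i.e. Pr(x|x) > Pr(x|y) for all x, y ∈ (ℤ/2ℤ)^n with y ≠ x, if and only if p + q < 1. -/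
theorem bacPr1_nonneg {p q : ℝ} (hp : p ∈ Set.Icc (0 : ℝ) 1) (hq : q ∈ Set.Icc (0 : ℝ) 1)
    (x y : ZMod 2) : 0 ≤ bacPr1 p q x y := by
  obtain ⟨hp0, hp1⟩ := hp
  obtain ⟨hq0, hq1⟩ := hq
  unfold bacPr1
  split_ifs <;> linarith

theorem bacPr1_lt_bacPr1_self {p q : ℝ} (h : p + q < 1) {x y : ZMod 2} (hxy : y ≠ x) :
    bacPr1 p q x y < bacPr1 p q x x := by
  have hzero : ∀ a b : ZMod 2, b ≠ a → (b = 0 ↔ a ≠ 0) := by decide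
  have hy := hzero x y hxy
  by_cases hx : x = 0
  · have hy0 : y ≠ 0 := fun h0 => hy.1 h0 hx
    simp only [bacPr1, hx, hy0, if_true, if_false]
    linarith
  · simp only [bacPr1, hx, hy.2 hx, if_true, if_false]
    linarith

theorem bacPr1_self_pos {p q : ℝ} (hp : p ∈ Set.Icc (0 : ℝ) 1) (hq : q ∈ Set.Icc (0 : ℝ) 1)
    (h : p + q < 1) (x : ZMod 2) : 0 < bacPr1 p q x x :=
  have hne : x + 1 ≠ x := by simp
  (bacPr1_nonneg hp hq x (x + 1)).trans_lt (bacPr1_lt_bacPr1_self h hne)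

theorem bacPr1_le_bacPr1_self {p q : ℝ} (h : p + q < 1) (x y : ZMod 2) :
    bacPr1 p q x y ≤ bacPr1 p q x x := by
  rcases eq_or_ne y x with rfl | hxy
  · exact le_rfl
  · exact (bacPr1_lt_bacPr1_self h hxy).le

/-- For `n ≥ 1` and `p, q ∈ [0,1]`, the channel `BAC^n(p,q)` is reasonable
(i.e. `Pr(x|x) > Pr(x|y)` for all `y ≠ x`) iff `p + q < 1`. -/
theorem stmt13 (n : ℕ) (hn : 1 ≤ n) (p q : ℝ)
    (hp : p ∈ Set.Icc (0 : ℝ) 1) (hq : q ∈ Set.Icc (0 : ℝ) 1) :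
    (∀ x y : Fin n → ZMod 2, y ≠ x → bacPr p q n x y < bacPr p q n x x) ↔
      p + q < 1 := by
  constructor
  · intro h
    have hne : (fun _ => 1 : Fin n → ZMod 2) ≠ fun _ => 0 := fun he =>
      one_ne_zero (congrFun he ⟨0, hn⟩)
    have hpow := h _ _ hne
    simp only [bacPr, bacPr1, one_ne_zero, if_true, if_false, Finset.prod_const,
      Finset.card_univ, Fintype.card_fin] at hpow
    have hlt := lt_of_pow_lt_pow_left₀ n (sub_nonneg.2 hp.2) hpow
    linarith
  · intro h x y hxy
    obtain ⟨i, hi⟩ := Function.ne_iff.1 hxy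
    unfold bacPr
    rw [← Finset.mul_prod_erase _ _ (Finset.mem_univ i),
      ← Finset.mul_prod_erase _ (fun j => bacPr1 p q (x j) (x j)) (Finset.mem_univ i)]
    exact mul_lt_mul_of_lt_of_le_of_nonneg_of_pos (bacPr1_lt_bacPr1_self h hi)
      (Finset.prod_le_prod (fun j _ => bacPr1_nonneg hp hq _ _)
        fun j _ => bacPr1_le_bacPr1_self h _ _)
      (bacPr1_nonneg hp hq _ _) (Finset.prod_pos fun j _ => bacPr1_self_pos hp hq h _)
end

section
/- Let W be a reasonable channel on a finite set X with at least two elements, and let f be a real-valued function on pairs of distinct elements of X with f(x,y) ≥ 0, which is symmetric (f(x,y) = f(y,x) for all x ≠ y) and coherent with W (for all x, y, z ∈ X with x ≠ y and x ≠ z: Pr(x|y) ≤ Pr(x|z) ⟺ f(x,y) ≤ f(x,z)). Let N = max{f(x,y) : x ≠ y} and suppose N > 0. Then the function d defined by d(x,y) = 3N − f(x,y) for x ≠ y and d(x,x) = 0 is a metric on X matched to W. -/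
/-- If `f` is a nonnegative symmetric function on pairs of distinct elements
which is coherent with a reasonable channel `W`, and `N > 0` is the maximum
value of `f`, then `d(x,y) = 3N - f(x,y)` for `x ≠ y` (and `d(x,x) = 0`) is a
metric matched to `W`. -/
theorem stmt14 {X : Type*} [Fintype X] [DecidableEq X] [Nontrivial X]
    (Pr : X → X → ℝ) (hch : IsChannel Pr) (hre : Reasonable Pr)
    (f : X → X → ℝ) (hf0 : ∀ x y : X, x ≠ y → 0 ≤ f x y)
    (hsymm : ∀ x y : X, x ≠ y → f x y = f y x)
    (hcoh : ∀ x y z : X, x ≠ y → x ≠ z → (Pr x y ≤ Pr x z ↔ f x y ≤ f x z))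
    (N : ℝ) (hub : ∀ x y : X, x ≠ y → f x y ≤ N)
    (hmem : ∃ x y : X, x ≠ y ∧ f x y = N) (hNpos : 0 < N) :
    IsMetric (fun x y => if x = y then 0 else 3 * N - f x y) ∧
      Matched Pr (fun x y => if x = y then 0 else 3 * N - f x y) := by
  refine ⟨⟨fun x y => ?_, fun x y => ?_, fun x y z => ?_⟩, fun x y z => ?_⟩
  · by_cases h : x = y
    · simp [h]
    · have := hub x y h
      simp only [h, if_false, iff_false]
      linarith
  · by_cases h : x = y
    · simp [h]
    · simp [h, Ne.symm h, hsymm x y h]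
  · by_cases hxy : x = y
    · simp [hxy]
    by_cases hyz : y = z
    · simp [hyz]
    have h₁ := hub x y hxy
    have h₂ := hub y z hyz
    by_cases hxz : x = z
    · subst hxz
      simp only [hxy, hyz, if_true, if_false]
      linarith
    · have h₃ := hf0 x z hxz
      simp only [hxy, hyz, hxz, if_false]
      linarith
  · by_cases hxy : x = y
    · subst hxy
      by_cases hxz : x = z
      · simp [← hxz]
      · have h₁ := hub x z hxz
        simp only [hxz, if_true, if_false]
        exact iff_of_false (hre x z (Ne.symm hxz)).not_ge (by linarith)
    · have h₁ := hub x y hxy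
      by_cases hxz : x = z
      · subst hxz
        simp only [hxy, if_true, if_false]
        exact iff_of_true (hre x y (Ne.symm hxy)).le (by linarith)
      · simp only [hxy, hxz, if_false, hcoh x y z hxy hxz, sub_le_sub_iff_left]
end

section
/- Let X = {0,1,2} and let Pr : X × X → ℝ be given by Pr(0|0) = 1/2, Pr(0|1) = 1/4, Pr(0|2) = 1/4, Pr(1|0) = 1/4, Pr(1|1) = 5/12, Pr(1|2) = 1/3, Pr(2|0) = 1/4, Pr(2|1) = 1/6, Pr(2|2) = 7/12. Then: (a) the directed graph G_1 with vertex set the 2-element subsets of X and an edge from {x,y} to {x,z} whenever y ≠ z and Pr(x|y) < Pr(x|z) is acyclic; (b) there is no metric d on X such that for all x, y, z ∈ X: Pr(x|y) ≤ Pr(x|z) ⟺ d(x,y) ≥ d(x,z). -/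
/-- The channel of Example 1: `pr16 x y = Pr(x|y)` with alphabet `{0,1,2}`. -/
noncomputable def pr16 : Fin 3 → Fin 3 → ℝ :=
  ![![1/2, 1/4, 1/4], ![1/4, 5/12, 1/3], ![1/4, 1/6, 7/12]]

/-- A directed graph with a function to a linear order strictly increasing along edges is acyclic. -/
theorem acyclic_of_strictMono_along {V : Type*} {E : V → V → Prop} {α : Type*} [LinearOrder α]
    (f : V → α) (hf : ∀ v w, E v w → f v < f w) : Acyclic E := by
  intro r hr v h
  obtain ⟨i, hi, hmax⟩ := (Finset.range r).exists_max_image (fun i => f (v i))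
    ⟨0, Finset.mem_range.2 hr⟩
  exact (hf _ _ (h i (Finset.mem_range.1 hi))).not_ge
    (hmax _ (Finset.mem_range.2 (Nat.mod_lt _ hr)))

theorem g1Edge_pr16 {v w : Finset (Fin 3)} (h : G1Edge pr16 v w) :
    (v = {1, 0} ∧ w = {1, 2}) ∨ (v = {2, 1} ∧ w = {2, 0}) := by
  obtain ⟨x, y, z, hxy, hxz, hyz, rfl, rfl, hlt⟩ := h
  fin_cases x <;> fin_cases y <;> fin_cases z <;> simp at hxy hxz hyz <;>
    first
    | (exfalso; norm_num [pr16] at hlt; done)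
    | exact Or.inl ⟨rfl, rfl⟩
    | exact Or.inr ⟨rfl, rfl⟩

/-- For the channel `pr16`: (a) the graph `G₁` is acyclic, and (b) there is no
metric on the alphabet matched to the channel. -/
theorem stmt16 :
    Acyclic (G1Edge pr16) ∧
      ¬ ∃ d : Fin 3 → Fin 3 → ℝ, IsMetric d ∧ Matched pr16 d := by
  constructor
  · refine acyclic_of_strictMono_along
      (fun v => if v = {1, 0} then 0 else if v = {1, 2} then 1 else 2) fun v w h => ?_
    rcases g1Edge_pr16 h with ⟨rfl, rfl⟩ | ⟨rfl, rfl⟩ <;> decide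
  · rintro ⟨d, ⟨-, hsymm, -⟩, hd⟩
    have h₀ : d 0 1 ≤ d 0 2 := (hd 0 2 1).1 (by simp [pr16])
    have h₁ : d 1 2 ≤ d 1 0 := (hd 1 0 2).1 (by simp [pr16]; norm_num)
    have h₂ : ¬ d 2 1 ≤ d 2 0 := mt (hd 2 0 1).2 (by simp [pr16]; norm_num)
    linarith [hsymm 0 1, hsymm 0 2, hsymm 1 2]
end

section
/- Let X = {0,1,2,3} and let Pr : X × X → ℝ be given by the matrix with entries Pr(x_i|x_j) equal to, for rows i = 0,1,2,3 and columns j = 0,1,2,3: row 0: 4/9, 2/9, 2/9, 1/9; row 1: 2/9, 4/9, 2/9, 1/9; row 2: 3/10, 1/5, 2/5, 1/10; row 3: 1/8, 1/8, 1/4, 1/2. Then: (a) the directed graph G_1 with vertex set the 2-element subsets of X and an edge from {x,y} to {x,z} whenever y ≠ z and Pr(x|y) < Pr(x|z) is transitive; (b) there is no metric d on X such that for all x, y, z ∈ X: Pr(x|y) ≤ Pr(x|z) ⟺ d(x,y) ≥ d(x,z). -/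
/-- The channel of Example 2: `pr17 x y = Pr(x|y)` with alphabet `{0,1,2,3}`. -/
noncomputable def pr17 : Fin 4 → Fin 4 → ℝ :=
  ![![4/9, 2/9, 2/9, 1/9], ![2/9, 4/9, 2/9, 1/9],
    ![3/10, 1/5, 2/5, 1/10], ![1/8, 1/8, 1/4, 1/2]]

/-- The edges of the graph `G₁` of the channel `pr17`. -/
def edges17 : Finset (Finset (Fin 4) × Finset (Fin 4)) :=
  {({0, 3}, {0, 1}), ({0, 3}, {0, 2}), ({0, 3}, {2, 3}),
    ({1, 3}, {0, 1}), ({1, 3}, {1, 2}), ({1, 3}, {2, 3}),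
    ({2, 3}, {1, 2}), ({2, 3}, {0, 2}), ({1, 2}, {0, 2})}

/-- The pairs of vertices of `G₁` joined by a directed path. -/
def reachable17 : Finset (Finset (Fin 4) × Finset (Fin 4)) :=
  edges17 ∪ {({0, 3}, {1, 2}), ({1, 3}, {0, 2})}

/-- The channel `pr17` with its entries multiplied by `360`. -/
def scaledPr17 : Fin 4 → Fin 4 → ℕ :=
  ![![160, 80, 80, 40], ![80, 160, 80, 40], ![108, 72, 144, 36], ![45, 45, 90, 180]]

theorem pr17_eq (x y : Fin 4) : pr17 x y = scaledPr17 x y / 360 := by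
  fin_cases x <;> fin_cases y <;> norm_num [pr17, scaledPr17]

theorem pr17_lt_iff (x y z : Fin 4) : pr17 x y < pr17 x z ↔ scaledPr17 x y < scaledPr17 x z := by
  rw [pr17_eq, pr17_eq, div_lt_div_iff_of_pos_right (by norm_num), Nat.cast_lt]

theorem pr17_le_iff (x y z : Fin 4) : pr17 x y ≤ pr17 x z ↔ scaledPr17 x y ≤ scaledPr17 x z := by
  rw [← not_lt, pr17_lt_iff, not_lt]

theorem G1Edge.mem_edges17 {v w : Finset (Fin 4)} (h : G1Edge pr17 v w) : (v, w) ∈ edges17 := by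
  obtain ⟨x, y, z, hxy, hxz, hyz, rfl, rfl, hlt⟩ := h
  rw [pr17_lt_iff] at hlt
  revert x y z
  decide

set_option maxRecDepth 10000 in
theorem g1Edge_of_mem_edges17 {p : Finset (Fin 4) × Finset (Fin 4)} (h : p ∈ edges17) :
    G1Edge pr17 p.1 p.2 := by
  simp only [G1Edge, pr17_lt_iff]
  revert p
  decide

set_option maxRecDepth 10000 in
theorem reachable17_trans :
    ∀ p ∈ reachable17, ∀ q ∈ edges17, p.2 = q.1 → (p.1, q.2) ∈ reachable17 := by
  decide

set_option maxRecDepth 10000 in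
theorem mem_edges17_of_card_inter :
    ∀ p ∈ reachable17, (p.1 ∩ p.2).card = 1 → p ∈ edges17 := by
  decide

theorem mem_reachable17_of_path (v : ℕ → Finset (Fin 4)) (n : ℕ)
    (h : ∀ i ≤ n, G1Edge pr17 (v i) (v (i + 1))) : (v 0, v (n + 1)) ∈ reachable17 := by
  induction n with
  | zero => exact Finset.mem_union_left _ (h 0 le_rfl).mem_edges17
  | succ n ih =>
    exact reachable17_trans _ (ih fun i hi => h i (hi.trans n.le_succ)) _
      (h (n + 1) le_rfl).mem_edges17 rfl

theorem transitiveGraph_pr17 : TransitiveGraph (G1Edge pr17) := by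
  intro r hr v hv hcard
  obtain ⟨n, rfl⟩ := Nat.exists_eq_add_of_le' hr
  exact g1Edge_of_mem_edges17 (mem_edges17_of_card_inter _
    (mem_reachable17_of_path v n fun i hi => hv i (by omega)) hcard)

theorem not_matched_pr17 {d : Fin 4 → Fin 4 → ℝ} (hd : IsMetric d) : ¬ Matched pr17 d := by
  intro hm
  have key (x y z : Fin 4) : scaledPr17 x y ≤ scaledPr17 x z ↔ d x z ≤ d x y :=
    (pr17_le_iff x y z).symm.trans (hm x y z)
  have h₂ : ¬ d 2 1 ≤ d 2 0 := (key 2 0 1).not.1 (by decide)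
  have h₀ : d 0 1 ≤ d 0 2 := (key 0 2 1).1 (by decide)
  have h₁ : d 1 2 ≤ d 1 0 := (key 1 0 2).1 (by decide)
  linarith [hd.2.1 0 1, hd.2.1 0 2, hd.2.1 1 2]

/-- For the channel `pr17`: (a) the graph `G₁` is transitive, and (b) there is
no metric on the alphabet matched to the channel. -/
theorem stmt17 :
    TransitiveGraph (G1Edge pr17) ∧
      ¬ ∃ d : Fin 4 → Fin 4 → ℝ, IsMetric d ∧ Matched pr17 d :=
  ⟨transitiveGraph_pr17, fun ⟨_, hd, hm⟩ => not_matched_pr17 hd hm⟩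
end

section
/- Let P be a finite poset, let h be a height function on P, and let A ⊆ P be a nonempty antichain. Set t = max{h(a) : a ∈ A} and define h'(x) = max{h(x) + t − h(a) : a ∈ A, a ≤ x} if there exists a ∈ A with a ≤ x, and h'(x) = h(x) otherwise. Then h' is a height function on P, h'(a) = t for every a ∈ A (so A is horizontal with respect to h'), and h'(x) = h(x) for every x ∈ P having no element of A below or equal to it. -/
/-- The adjusted height: `adjustedHeight h A t x = max {h x + t - h a : a ∈ A, a ≤ x}`
if some element of `A` is `≤ x`, and `h x` otherwise. -/
def adjustedHeight {P : Type*} [PartialOrder P] [DecidableEq P]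
    [DecidableRel ((· ≤ ·) : P → P → Prop)]
    (h : P → ℕ) (A : Finset P) (t : ℕ) (x : P) : ℕ :=
  if hx : (A.filter (· ≤ x)).Nonempty then
    (A.filter (· ≤ x)).sup' hx (fun a => h x + t - h a)
  else h x

theorem le_adjustedHeight {P : Type*} [PartialOrder P] [DecidableEq P]
    [DecidableRel ((· ≤ ·) : P → P → Prop)]
    (h : P → ℕ) {A : Finset P} (t : ℕ) {a x : P} (ha : a ∈ A) (hax : a ≤ x) :
    h x + t - h a ≤ adjustedHeight h A t x := by
  have hmem : a ∈ A.filter (· ≤ x) := Finset.mem_filter.2 ⟨ha, hax⟩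
  rw [adjustedHeight, dif_pos ⟨a, hmem⟩]
  exact Finset.le_sup' (fun a => h x + t - h a) hmem

theorem adjustedHeight_of_forall_not_le {P : Type*} [PartialOrder P] [DecidableEq P]
    [DecidableRel ((· ≤ ·) : P → P → Prop)]
    (h : P → ℕ) {A : Finset P} (t : ℕ) {x : P} (hx : ¬ ∃ a ∈ A, a ≤ x) :
    adjustedHeight h A t x = h x := by
  refine dif_neg fun ⟨a, ha⟩ => hx ⟨a, ?_⟩
  simpa using ha

theorem exists_adjustedHeight_eq {P : Type*} [PartialOrder P] [DecidableEq P]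
    [DecidableRel ((· ≤ ·) : P → P → Prop)]
    (h : P → ℕ) {A : Finset P} (t : ℕ) {x : P} (hx : ∃ a ∈ A, a ≤ x) :
    ∃ a ∈ A, a ≤ x ∧ adjustedHeight h A t x = h x + t - h a := by
  obtain ⟨b, hb, hbx⟩ := hx
  have hne : (A.filter (· ≤ x)).Nonempty := ⟨b, Finset.mem_filter.2 ⟨hb, hbx⟩⟩
  obtain ⟨a, ha, hmax⟩ := Finset.exists_mem_eq_sup' hne (fun a => h x + t - h a)
  obtain ⟨haA, hax⟩ := Finset.mem_filter.1 ha
  exact ⟨a, haA, hax, by rw [adjustedHeight, dif_pos hne, hmax]⟩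

/-- Let `h` be a height function on a finite poset `P` (`x < y → h x < h y`), let
`A` be a nonempty antichain and `t = max {h a : a ∈ A}`. Then the adjusted height
`h'` is a height function, `h' a = t` for every `a ∈ A` (so `A` is horizontal with
respect to `h'`), and `h' x = h x` for every `x` with no element of `A` below or
equal to it. -/
theorem stmt19 {P : Type*} [PartialOrder P] [Fintype P] [DecidableEq P]
    [DecidableRel ((· ≤ ·) : P → P → Prop)]
    (h : P → ℕ) (hh : ∀ x y : P, x < y → h x < h y)
    (A : Finset P) (hA : A.Nonempty)
    (hanti : ∀ a ∈ A, ∀ b ∈ A, a ≤ b → a = b) :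
    (∀ x y : P, x < y →
        adjustedHeight h A (A.sup' hA h) x < adjustedHeight h A (A.sup' hA h) y) ∧
      (∀ a ∈ A, adjustedHeight h A (A.sup' hA h) a = A.sup' hA h) ∧
      (∀ x : P, ¬ (∃ a ∈ A, a ≤ x) → adjustedHeight h A (A.sup' hA h) x = h x) := by
  have hle : ∀ a ∈ A, h a ≤ A.sup' hA h := fun a ha => Finset.le_sup' h ha
  refine ⟨fun x y hxy => ?_, fun a ha => ?_, fun x => adjustedHeight_of_forall_not_le h _⟩
  · have hlt := hh x y hxy
    by_cases hx : ∃ a ∈ A, a ≤ x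
    · obtain ⟨a, ha, hax, heq⟩ := exists_adjustedHeight_eq h (A.sup' hA h) hx
      have := le_adjustedHeight h (A.sup' hA h) ha (hax.trans hxy.le)
      have := hle a ha
      omega
    · rw [adjustedHeight_of_forall_not_le h _ hx]
      by_cases hy : ∃ a ∈ A, a ≤ y
      · obtain ⟨a, ha, -, heq⟩ := exists_adjustedHeight_eq h (A.sup' hA h) hy
        have := hle a ha
        omega
      · rwa [adjustedHeight_of_forall_not_le h _ hy]
  · obtain ⟨b, hb, hba, heq⟩ := exists_adjustedHeight_eq h (A.sup' hA h) ⟨a, ha, le_rfl⟩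
    obtain rfl := hanti b hb a ha hba
    omega
end
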